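/- Suppose that for every t ∈ ℤ there exist ε > 0 and a strictly decreasing sequence of integers t = t_0 > t_1 > t_2 > ⋯ with δ(P^{t_k, t_{k−1}}) ≤ 1 − ε for every k ≥ 1. Then for every t ∈ ℤ the entrywise limit Q^t := lim_{s→−∞} P^{s,t} exists, all rows of Q^t coincide (δ(Q^t) = 0), and hence π_t(y) := Q^t(1,y) defines a probability vector on [n] with Q^t(x,·) = π_t for every x. -/

import Mathlib

open Filter

/-- A row-stochastic `n × n` real matrix. -/
def IsStochastic (n : ℕ) (P : Matrix (Fin n) (Fin n) ℝ) : Prop :=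
  (∀ x y, 0 ≤ P x y) ∧ ∀ x, ∑ y, P x y = 1

/-- Dobrushin ergodic coefficient. -/
noncomputable def dob (n : ℕ) (P : Matrix (Fin n) (Fin n) ℝ) : ℝ :=
  ⨆ x : Fin n, ⨆ y : Fin n, (1 / 2) * ∑ z, |P x z - P y z|

/-- The product `P^{s,t} = P_{s+1} P_{s+2} ⋯ P_t` (the identity when `s ≥ t`). -/
noncomputable def mprod (n : ℕ) (P : ℤ → Matrix (Fin n) (Fin n) ℝ) (s t : ℤ) :
    Matrix (Fin n) (Fin n) ℝ :=
  ((List.range (t - s).toNat).map (fun i => P (s + 1 + i))).prod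

lemma IsStochastic.one (n : ℕ) : IsStochastic n 1 := by
  refine ⟨fun x y => ?_, fun x => by simp [Matrix.one_apply]⟩
  rw [Matrix.one_apply]
  split_ifs <;> norm_num

lemma IsStochastic.mul {n : ℕ} {A B : Matrix (Fin n) (Fin n) ℝ} (hA : IsStochastic n A)
    (hB : IsStochastic n B) : IsStochastic n (A * B) := by
  refine ⟨fun x y => ?_, fun x => ?_⟩
  · rw [Matrix.mul_apply]
    exact Finset.sum_nonneg fun z _ => mul_nonneg (hA.1 x z) (hB.1 z y)
  · simp only [Matrix.mul_apply]
    rw [Finset.sum_comm]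
    simp only [← Finset.mul_sum, hB.2, mul_one, hA.2]

lemma IsStochastic.mprod {n : ℕ} {P : ℤ → Matrix (Fin n) (Fin n) ℝ}
    (hP : ∀ s, IsStochastic n (P s)) (s t : ℤ) : IsStochastic n (mprod n P s t) := by
  refine List.prod_induction _ (fun _ _ => IsStochastic.mul) (IsStochastic.one n) fun A hA => ?_
  obtain ⟨i, -, rfl⟩ := List.mem_map.1 hA
  exact hP _

lemma mprod_eq_prod_map (n : ℕ) (P : ℤ → Matrix (Fin n) (Fin n) ℝ) (s t : ℤ) :
    mprod n P s t = ((List.range (t - s).toNat).map fun i : ℕ => P (s + 1 + (i : ℤ))).prod := by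
  simp [mprod, List.map_eq_flatMap, List.flatMap_assoc]

lemma mprod_mul_mprod (n : ℕ) (P : ℤ → Matrix (Fin n) (Fin n) ℝ) {s u t : ℤ} (hsu : s ≤ u)
    (hut : u ≤ t) : mprod n P s u * mprod n P u t = mprod n P s t := by
  obtain ⟨a, rfl⟩ := Int.le.dest hsu
  obtain ⟨b, rfl⟩ := Int.le.dest hut
  have h₁ : (s + a - s).toNat = a := by lia
  have h₂ : (s + a + b - (s + a)).toNat = b := by lia
  have h₃ : (s + a + b - s).toNat = a + b := by lia
  rw [mprod_eq_prod_map, mprod_eq_prod_map, mprod_eq_prod_map, h₁, h₂, h₃, List.range_add,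
    List.map_append, List.prod_append, List.map_map]
  congr 3
  funext i
  simp only [Function.comp_apply]
  congr 1
  push_cast
  ring

lemma half_sum_abs_le_dob {n : ℕ} (A : Matrix (Fin n) (Fin n) ℝ) (x y : Fin n) :
    (1 / 2) * ∑ z, |A x z - A y z| ≤ dob n A :=
  (le_ciSup (f := fun y => (1 / 2) * ∑ z, |A x z - A y z|) (Set.finite_range _).bddAbove y).trans
    (le_ciSup (f := fun x => ⨆ y, (1 / 2) * ∑ z, |A x z - A y z|)
      (Set.finite_range _).bddAbove x)

lemma exists_midpoint {ι : Type*} [Finite ι] [Nonempty ι] {f : ι → ℝ} {c : ℝ}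
    (hf : ∀ a b, |f a - f b| ≤ c) : ∃ m, ∀ a, |f a - m| ≤ c / 2 := by
  obtain ⟨p, hp⟩ := Finite.exists_max f
  obtain ⟨q, hq⟩ := Finite.exists_min f
  refine ⟨(f p + f q) / 2, fun a => abs_le.2 ?_⟩
  have := (abs_le.1 (hf p q)).2
  constructor <;> linarith [hp a, hq a]

/-- A stochastic matrix contracts oscillations of vectors by its Dobrushin coefficient. -/
lemma IsStochastic.abs_sub_le_dob_mul {n : ℕ} {A : Matrix (Fin n) (Fin n) ℝ}
    (hA : IsStochastic n A) {f : Fin n → ℝ} {c : ℝ} (hf : ∀ a b, |f a - f b| ≤ c)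
    (x y : Fin n) : |∑ z, A x z * f z - ∑ z, A y z * f z| ≤ dob n A * c := by
  have : Nonempty (Fin n) := ⟨x⟩
  have hc : 0 ≤ c := (abs_nonneg _).trans (hf x x)
  obtain ⟨m, hm⟩ := exists_midpoint hf
  have key : ∑ z, A x z * f z - ∑ z, A y z * f z = ∑ z, (A x z - A y z) * (f z - m) := by
    simp only [sub_mul, mul_sub, Finset.sum_sub_distrib, ← Finset.sum_mul, hA.2]
    ring
  calc |∑ z, A x z * f z - ∑ z, A y z * f z|
      ≤ ∑ z, |A x z - A y z| * |f z - m| := by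
        rw [key]
        simpa only [abs_mul] using
          Finset.abs_sum_le_sum_abs (fun z => (A x z - A y z) * (f z - m)) Finset.univ
    _ ≤ ∑ z, |A x z - A y z| * (c / 2) := by
        gcongr with z
        exact hm z
    _ = (1 / 2) * (∑ z, |A x z - A y z|) * c := by
        rw [← Finset.sum_mul]
        ring
    _ ≤ dob n A * c := by
        gcongr
        exact half_sum_abs_le_dob A x y

lemma IsStochastic.abs_sum_mul_sub_le {n : ℕ} {A : Matrix (Fin n) (Fin n) ℝ}
    (hA : IsStochastic n A) {f : Fin n → ℝ} {r c : ℝ} (hf : ∀ a, |f a - r| ≤ c) (x : Fin n) :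
    |∑ z, A x z * f z - r| ≤ c := by
  have key : ∑ z, A x z * f z - r = ∑ z, A x z * (f z - r) := by
    simp only [mul_sub, Finset.sum_sub_distrib, ← Finset.sum_mul, hA.2, one_mul]
  calc |∑ z, A x z * f z - r| ≤ ∑ z, |A x z * (f z - r)| := by
        rw [key]
        exact Finset.abs_sum_le_sum_abs _ _
    _ = ∑ z, A x z * |f z - r| := by simp only [abs_mul, abs_of_nonneg (hA.1 _ _)]
    _ ≤ ∑ z, A x z * c := by
        gcongr with z
        · exact hA.1 x z
        · exact hf z
    _ = c := by rw [← Finset.sum_mul, hA.2, one_mul]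

lemma IsStochastic.le_one {n : ℕ} {A : Matrix (Fin n) (Fin n) ℝ} (hA : IsStochastic n A)
    (x y : Fin n) : A x y ≤ 1 :=
  hA.2 x ▸ Finset.single_le_sum (fun z _ => hA.1 x z) (Finset.mem_univ y)

lemma abs_mprod_sub_le_pow {n : ℕ} {P : ℤ → Matrix (Fin n) (Fin n) ℝ}
    (hP : ∀ s, IsStochastic n (P s)) {ρ : ℝ} {τ : ℕ → ℤ} (hτ : StrictAnti τ)
    (hρ : ∀ k, dob n (mprod n P (τ (k + 1)) (τ k)) ≤ ρ) (y : Fin n) (k : ℕ) :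
    ∀ a b, |mprod n P (τ k) (τ 0) a y - mprod n P (τ k) (τ 0) b y| ≤ ρ ^ k := by
  induction k with
  | zero =>
    intro a b
    have h := IsStochastic.mprod hP (τ 0) (τ 0)
    rw [pow_zero, abs_le]
    constructor <;> linarith [h.1 a y, h.1 b y, h.le_one a y, h.le_one b y]
  | succ k ih =>
    intro a b
    rw [← mprod_mul_mprod n P (hτ k.lt_succ_self).le (hτ.antitone k.zero_le), pow_succ',
      Matrix.mul_apply, Matrix.mul_apply]
    refine ((IsStochastic.mprod hP _ _).abs_sub_le_dob_mul ih a b).trans ?_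
    have : 0 ≤ ρ ^ k := (abs_nonneg _).trans (ih a a)
    gcongr
    exact hρ k

lemma exists_forall_le_abs_mprod_sub_lt {n : ℕ} {P : ℤ → Matrix (Fin n) (Fin n) ℝ}
    (hP : ∀ s, IsStochastic n (P s)) {ρ : ℝ} (hρ₁ : ρ < 1) {τ : ℕ → ℤ} (hτ : StrictAnti τ)
    (hρ : ∀ k, dob n (mprod n P (τ (k + 1)) (τ k)) ≤ ρ) (y : Fin n) {e : ℝ} (he : 0 < e) :
    ∃ S : ℤ, ∀ s ≤ S, ∀ s' ≤ S, ∀ a b,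
      |mprod n P s (τ 0) a y - mprod n P s' (τ 0) b y| < e := by
  obtain ⟨k, hk⟩ := exists_pow_lt_of_lt_one (half_pos he) hρ₁
  have near : ∀ s ≤ τ k, ∀ a b,
      |mprod n P s (τ 0) a y - mprod n P (τ k) (τ 0) b y| ≤ ρ ^ k := by
    intro s hs a b
    rw [← mprod_mul_mprod n P hs (hτ.antitone k.zero_le), Matrix.mul_apply]
    exact (IsStochastic.mprod hP _ _).abs_sum_mul_sub_le
      (fun z => abs_mprod_sub_le_pow hP hτ hρ y k z b) a
  refine ⟨τ k, fun s hs s' hs' a b => ?_⟩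
  have h₁ := abs_le.1 (near s hs a a)
  have h₂ := abs_le.1 (near s' hs' b a)
  rw [abs_lt]
  constructor <;> linarith [h₁.1, h₁.2, h₂.1, h₂.2]

/-- If for every `t` there are `ε > 0` and a strictly decreasing sequence
`t = t₀ > t₁ > t₂ > ⋯` with `δ(P^{t_k, t_{k-1}}) ≤ 1 - ε` for all `k ≥ 1`, then for
every `t` the entrywise limit `Q^t = lim_{s → −∞} P^{s,t}` exists, all rows of `Q^t`
coincide (`δ(Q^t) = 0`), and `π_t(y) := Q^t(1,y)` is a probability vector with
`Q^t(x,·) = π_t` for every `x`. -/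
theorem target_distribution_exists (n : ℕ) (hn : 1 ≤ n)
    (P : ℤ → Matrix (Fin n) (Fin n) ℝ) (hP : ∀ s, IsStochastic n (P s))
    (hseq : ∀ t : ℤ, ∃ ε : ℝ, 0 < ε ∧ ∃ tk : ℕ → ℤ, tk 0 = t ∧ StrictAnti tk ∧
      ∀ k : ℕ, dob n (mprod n P (tk (k + 1)) (tk k)) ≤ 1 - ε) :
    ∀ t : ℤ, ∃ Q : Matrix (Fin n) (Fin n) ℝ,
      (∀ x y, Tendsto (fun s : ℤ => mprod n P s t x y) atBot (nhds (Q x y))) ∧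
      dob n Q = 0 ∧
      (∀ y, 0 ≤ Q ⟨0, hn⟩ y) ∧ (∑ y, Q ⟨0, hn⟩ y = 1) ∧
      ∀ x y, Q x y = Q ⟨0, hn⟩ y := by
  intro t
  obtain ⟨ε, hε, τ, rfl, hτ, hρ⟩ := hseq t
  have osc := fun y e => exists_forall_le_abs_mprod_sub_lt hP (sub_lt_self 1 hε) hτ hρ y (e := e)
  have lim : ∀ x y, ∃ q, Tendsto (fun s : ℤ => mprod n P s (τ 0) x y) atBot (nhds q) := by
    intro x y
    refine cauchy_iff_exists_le_nhds.1 (Metric.cauchy_iff.2 ⟨inferInstance, fun e he => ?_⟩)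
    obtain ⟨S, hS⟩ := osc y e he
    refine ⟨_, image_mem_map (Iic_mem_atBot S), ?_⟩
    rintro _ ⟨s, hs, rfl⟩ _ ⟨s', hs', rfl⟩
    exact hS s hs s' hs' x x
  choose Q hQ using lim
  have rows : ∀ x x' y, Q x y = Q x' y := by
    intro x x' y
    refine sub_eq_zero.1 (tendsto_nhds_unique ((hQ x y).sub (hQ x' y)) ?_)
    refine Metric.tendsto_nhds.2 fun e he => ?_
    obtain ⟨S, hS⟩ := osc y e he
    filter_upwards [Iic_mem_atBot S] with s hs
    simpa [Real.dist_eq] using hS s hs s hs x x'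
  refine ⟨Q, hQ, ?_, fun y => ?_, ?_, fun x y => rows x _ y⟩
  · have h : ∀ x y, (1 / 2) * ∑ z, |Q x z - Q y z| = 0 := fun x y => by
      simp [fun z => rows x y z]
    simp only [dob, h, Real.iSup_const_zero]
  · exact ge_of_tendsto' (hQ _ y) fun s => (IsStochastic.mprod hP s _).1 _ y
  · refine tendsto_nhds_unique (tendsto_finsetSum Finset.univ fun y _ => hQ ⟨0, hn⟩ y) ?_
    simp only [(IsStochastic.mprod hP _ _).2]
    exact tendsto_const_nhds
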